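/- arXiv:2211.14600 — 3 statements merged into one kernel-verified Lean document; each statement's English description precedes it below -/
import Mathlib

section
/- Let C and E be categories with finite limits and let N, M : C ⥤ E be functors preserving finite limits. If η : N ⟶ M is an elementary natural transformation (i.e. for every monomorphism i : a ⟶ x in C the naturality square with sides N i, η_x, M i, η_a is a pullback), then every component η_x : N x ⟶ M x is a monomorphism. -/
open CategoryTheory CategoryTheory.Limits

universe v u v' u'

namespace PosModel

variable {C : Type u} [Category.{v} C] {E : Type u'} [Category.{v'} E]

/-- A natural transformation is *elementary* if each naturality square at a
monomorphism is a pullback square. -/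
def Elementary {N M : C ⥤ E} (η : N ⟶ M) : Prop :=
  ∀ ⦃a x : C⦄ (i : a ⟶ x), Mono i →
    IsPullback (N.map i) (η.app a) (η.app x) (M.map i)

/-- If `η : N ⟶ M` is an elementary natural transformation between finite-limit
preserving functors (between finitely complete categories), then every component
of `η` is a monomorphism. -/
theorem mono_app_of_elementary [HasFiniteLimits C] [HasFiniteLimits E]
    (N M : C ⥤ E) [PreservesFiniteLimits N] [PreservesFiniteLimits M]
    (η : N ⟶ M) (hη : Elementary η) (x : C) : Mono (η.app x) := by
  constructor
  intro Z f g hfg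
  let p : Z ⟶ N.obj (x ⨯ x) := prod.lift f g ≫ inv (prodComparison N x x)
  have hp₁ : p ≫ N.map prod.fst = f := by
    rw [Category.assoc, inv_prodComparison_map_fst, prod.lift_fst]
  have hp₂ : p ≫ N.map prod.snd = g := by
    rw [Category.assoc, inv_prodComparison_map_snd, prod.lift_snd]
  let δ : x ⟶ x ⨯ x := prod.lift (𝟙 x) (𝟙 x)
  have hδ₁ : δ ≫ prod.fst = 𝟙 x := prod.lift_fst _ _
  have hδ₂ : δ ≫ prod.snd = 𝟙 x := prod.lift_snd _ _
  have hδ : Mono δ := mono_of_mono_fac hδ₁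
  have hp : p ≫ η.app (x ⨯ x) = (f ≫ η.app x) ≫ M.map δ := by
    rw [← cancel_mono (prodComparison M x x)]
    apply Limits.prod.hom_ext
    · simp only [Category.assoc, prodComparison_fst, ← Functor.map_comp, hδ₁]
      rw [← η.naturality, reassoc_of% hp₁, M.map_id, Category.comp_id]
    · simp only [Category.assoc, prodComparison_snd, ← Functor.map_comp, hδ₂]
      rw [← η.naturality, reassoc_of% hp₂, M.map_id, Category.comp_id, hfg]
  obtain ⟨l, hl, -⟩ := (hη δ hδ).exists_lift p _ hp
  calc
    f = l ≫ N.map δ ≫ N.map prod.fst := by rw [reassoc_of% hl, hp₁]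
    _ = l ≫ N.map δ ≫ N.map prod.snd := by rw [← N.map_comp, ← N.map_comp, hδ₁, hδ₂]
    _ = g := by rw [reassoc_of% hl, hp₂]

end PosModel
end

section
/- Let L be a bounded distributive lattice, p a prime filter on L, and φ ∈ L. The following are equivalent: (1) φ ≠ ⊥ and every prime filter of L containing φ is contained in p; (2) for every ψ ∈ L, ψ ∈ p if and only if φ ⊓ ψ ≠ ⊥. -/
namespace PosModel

/-- A *prime filter* on a bounded distributive lattice: a proper filter `p`
(upward closed, closed under finite meets, containing `⊤` and not `⊥`) such that
`a ⊔ b ∈ p` implies `a ∈ p` or `b ∈ p`. -/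
structure IsPrimeFilter {L : Type*} [DistribLattice L] [BoundedOrder L] (p : Set L) : Prop where
  top_mem : ⊤ ∈ p
  bot_not_mem : ⊥ ∉ p
  mem_of_le : ∀ ⦃a b : L⦄, a ∈ p → a ≤ b → b ∈ p
  inf_mem : ∀ ⦃a b : L⦄, a ∈ p → b ∈ p → a ⊓ b ∈ p
  prime : ∀ ⦃a b : L⦄, a ⊔ b ∈ p → a ∈ p ∨ b ∈ p

/-- Prime filter theorem: every nonzero element of a bounded distributive lattice lies in a
prime filter. -/
theorem exists_isPrimeFilter_mem {L : Type*} [DistribLattice L] [BoundedOrder L] {a : L}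
    (ha : a ≠ ⊥) : ∃ q : Set L, IsPrimeFilter q ∧ a ∈ q := by
  have hdisj : Disjoint (Order.PFilter.principal a : Set L)
      (Order.Ideal.principal (⊥ : L) : Set L) := by
    refine Set.disjoint_left.2 fun x hx hx' => ha ?_
    exact le_bot_iff.1 ((Order.PFilter.mem_principal.1 hx).trans
      (Order.Ideal.mem_principal.1 hx'))
  obtain ⟨J, hJ, -, hFJ⟩ := DistribLattice.prime_ideal_of_disjoint_filter_ideal hdisj
  have haJ : a ∉ J := Set.disjoint_left.1 hFJ (Order.PFilter.mem_principal.2 le_rfl)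
  refine ⟨{x | x ∉ J}, ⟨?_, ?_, ?_, ?_, ?_⟩, haJ⟩
  · exact fun h => haJ (J.lower le_top h)
  · exact fun h => h J.bot_mem
  · exact fun x y hx hxy hy => hx (J.lower hxy hy)
  · exact fun x y hx hy hxy => (hJ.mem_or_mem hxy).elim hx hy
  · intro x y hxy
    by_contra! h
    exact hxy (Order.Ideal.sup_mem (not_not.1 h.1) (not_not.1 h.2))

/-- Let `L` be a bounded distributive lattice, `p` a prime filter on `L` and
`φ ∈ L`.  Then `φ` is nonzero with every prime filter containing `φ` contained
in `p` (i.e. `∅ ≠ [φ] ⊆ closure {p}` in `Spec L`) if and only if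
`ψ ∈ p ↔ φ ⊓ ψ ≠ ⊥` for every `ψ`. -/
theorem somewhere_dense_iff {L : Type*} [DistribLattice L] [BoundedOrder L]
    (p : Set L) (hp : IsPrimeFilter p) (φ : L) :
    (φ ≠ ⊥ ∧ ∀ q : Set L, IsPrimeFilter q → φ ∈ q → q ⊆ p) ↔
      (∀ ψ : L, ψ ∈ p ↔ φ ⊓ ψ ≠ ⊥) := by
  constructor
  · rintro ⟨hφ, h⟩ ψ
    constructor
    · intro hψ hbot
      obtain ⟨q, hq, hφq⟩ := exists_isPrimeFilter_mem hφ
      exact hp.bot_not_mem (hbot ▸ hp.inf_mem (h q hq hφq hφq) hψ)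
    · intro hne
      obtain ⟨q, hq, hmem⟩ := exists_isPrimeFilter_mem hne
      exact h q hq (hq.mem_of_le hmem inf_le_left) (hq.mem_of_le hmem inf_le_right)
  · intro h
    refine ⟨by simpa using (h ⊤).1 hp.top_mem, fun q hq hφq ψ hψ => (h ψ).2 fun hbot => ?_⟩
    exact hq.bot_not_mem (hbot ▸ hq.inf_mem hφq hψ)

end PosModel
end

section
/- Let C be a category with finite limits in which every morphism factors as an effective epimorphism followed by a monomorphism, effective epimorphisms are stable under pullback, and every internal equivalence relation admits a coequalizer of its two projections (Barr-exactness). Let ⟨q₁, q₂⟩ : Y ⟶ X ⨯ X be a (not necessarily monic) morphism such that: (reflexivity) there is r' : X ⟶ Y with q₁ ∘ r' = id_X and q₂ ∘ r' = id_X; (symmetry) there is an effective epimorphism s' : Y ⟶ Y with ⟨q₁, q₂⟩ ∘ s' = ⟨q₂, q₁⟩; (transitivity) letting Y ×_X Y be the pullback with projections q₁', q₂' satisfying q₂ ∘ q₁' = q₁ ∘ q₂', there is an effective epimorphism t' : Y ×_X Y ⟶ Y with ⟨q₁ ∘ q₁', q₂ ∘ q₂'⟩ = ⟨q₁, q₂⟩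 ∘ t'. Then the coequalizer of q₁ and q₂ exists. -/
open CategoryTheory CategoryTheory.Limits

universe v u

namespace PosModel

/-- In a finitely complete category with pullback-stable effective epi–mono
factorizations in which every internal equivalence relation admits a
coequalizer of its two projections (Barr-exactness), any pair
`q₁ q₂ : Y ⟶ X` satisfying the axioms of an internal equivalence relation
up to effective epimorphisms (with `⟨q₁, q₂⟩` not necessarily monic) admits a
coequalizer. -/
theorem hasCoequalizer_of_pseudoEquivalence {C : Type u} [Category.{v} C] [HasFiniteLimits C]
    -- every morphism factors as an effective epimorphism followed by a monomorphism
    (hfac : ∀ {X Y : C} (f : X ⟶ Y), ∃ (Z : C) (e : X ⟶ Z) (m : Z ⟶ Y),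
      EffectiveEpi e ∧ Mono m ∧ e ≫ m = f)
    -- effective epimorphisms are stable under pullback
    (hpb : ∀ {P X Y Z : C} (fst : P ⟶ X) (snd : P ⟶ Y) (f : X ⟶ Z) (g : Y ⟶ Z),
      IsPullback fst snd f g → EffectiveEpi g → EffectiveEpi fst)
    -- Barr-exactness: every internal equivalence relation admits a coequalizer
    -- of its two projections
    (hexact : ∀ {R X : C} (f g : R ⟶ X), Mono (prod.lift f g) →
      (∃ r : X ⟶ R, r ≫ f = 𝟙 X ∧ r ≫ g = 𝟙 X) →
      (∃ s : R ⟶ R, s ≫ prod.lift f g = prod.lift g f) →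
      (∃ t : pullback g f ⟶ R, t ≫ prod.lift f g =
        prod.lift (pullback.fst g f ≫ f) (pullback.snd g f ≫ g)) →
      HasCoequalizer f g)
    {Y X : C} (q₁ q₂ : Y ⟶ X)
    -- reflexivity
    (hrefl : ∃ r' : X ⟶ Y, r' ≫ q₁ = 𝟙 X ∧ r' ≫ q₂ = 𝟙 X)
    -- symmetry (up to an effective epimorphism)
    (hsymm : ∃ s' : Y ⟶ Y, EffectiveEpi s' ∧ s' ≫ prod.lift q₁ q₂ = prod.lift q₂ q₁)
    -- transitivity (up to an effective epimorphism)
    (htrans : ∃ t' : pullback q₂ q₁ ⟶ Y, EffectiveEpi t' ∧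
      t' ≫ prod.lift q₁ q₂ =
        prod.lift (pullback.fst q₂ q₁ ≫ q₁) (pullback.snd q₂ q₁ ≫ q₂)) :
    HasCoequalizer q₁ q₂ := by
  obtain ⟨R, e, m, he, hm, hem⟩ := hfac (prod.lift q₁ q₂)
  obtain ⟨f, g, rfl⟩ : ∃ f g : R ⟶ X, m = prod.lift f g :=
    ⟨m ≫ prod.fst, m ≫ prod.snd, by ext <;> simp [prod.lift_fst, prod.lift_snd]⟩
  obtain rfl : e ≫ f = q₁ := by
    simpa [prod.lift_fst] using hem =≫ prod.fst
  obtain rfl : e ≫ g = q₂ := by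
    simpa [prod.lift_snd] using hem =≫ prod.snd
  suffices HasCoequalizer f g from hasCoequalizer_epi_comp e
  refine hexact f g hm ?_ ?_ ?_
  · obtain ⟨r, h₁, h₂⟩ := hrefl
    exact ⟨r ≫ e, by simpa using h₁, by simpa using h₂⟩
  · obtain ⟨s, -, hs⟩ := hsymm
    have sq : CommSq (s ≫ e) e (prod.lift f g) (prod.lift g f) :=
      ⟨by rw [Category.assoc, hem, hs, prod.comp_lift]⟩
    exact ⟨sq.lift, sq.fac_right⟩
  · obtain ⟨t, -, ht⟩ := htrans
    -- Cover `R ×_X R` by pulling back `e` along each of the two projections in turn.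
    let a := pullback.fst (pullback.fst g f) e
    let b := pullback.fst (a ≫ pullback.snd g f) e
    have ha : EffectiveEpi a := hpb _ _ _ _ (IsPullback.of_hasPullback _ _) he
    have hb : EffectiveEpi b := hpb _ _ _ _ (IsPullback.of_hasPullback _ _) he
    have wa : a ≫ pullback.fst g f = pullback.snd _ _ ≫ e := pullback.condition
    have wb : b ≫ a ≫ pullback.snd g f = pullback.snd _ _ ≫ e := pullback.condition
    have hba : StrongEpi (b ≫ a) := strongEpi_comp b a
    let l : pullback (a ≫ pullback.snd g f) e ⟶ pullback (e ≫ g) (e ≫ f) :=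
      pullback.lift (b ≫ pullback.snd _ _) (pullback.snd _ _) (by
        rw [Category.assoc, ← reassoc_of% wa, ← reassoc_of% wb, pullback.condition])
    have sq : CommSq (l ≫ t ≫ e) (b ≫ a) (prod.lift f g)
        (prod.lift (pullback.fst g f ≫ f) (pullback.snd g f ≫ g)) := ⟨by
      simp only [Category.assoc]
      rw [hem, ht, prod.comp_lift, prod.comp_lift, prod.comp_lift]
      congr 1
      · simp [l, pullback.lift_fst_assoc, reassoc_of% wa]
      · simp [l, pullback.lift_snd_assoc, reassoc_of% wb]⟩
    exact ⟨sq.lift, sq.fac_right⟩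

end PosModel
end
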